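/- Let k ≥ 0, m = 2^k, h = 1/m, and let t_j = (2j+1)/(2m) and η_p = (2p+1)/(2m) denote the dyadic midpoints. Then for every 0 ≤ n ≤ m−1 and 0 ≤ j ≤ m−1, the integral of the n-th Walsh function up to the midpoint t_j is ∫₀^{t_j} w_n(s) ds = h·Σ_{p=0}^{j−1} w_n(η_p) + (h/2)·w_n(η_j). (This establishes the exactness at the collocation midpoints of the Walsh operational matrix of integration Λ = (1/m) T_W P T_W.) -/

import Mathlib

open MeasureTheory

/-- The `i`-th Rademacher function on `[0,1)`. -/
noncomputable def rademacher (i : ℕ) (t : ℝ) : ℝ :=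
  if i = 0 then 1 else Real.sign (Real.sin (2 ^ i * Real.pi * t))

/-- The `n`-th Walsh function, `w_n(t) = ∏_{i ≥ 1} rᵢ(t)^{bᵢ}` with
`n = ∑_{i ≥ 1} bᵢ 2^{i-1}` the binary expansion of `n`. -/
noncomputable def walsh (n : ℕ) (t : ℝ) : ℝ :=
  ∏ i ∈ Finset.range (n + 1), if n.testBit i then rademacher (i + 1) t else 1

/-- The function `rademacher (i + 1)` is constant on every open dyadic interval of length `2⁻ᵏ`
with `i < k`. -/
theorem rademacher_succ_eq_of_mem_Ioo {i k p : ℕ} (hi : i < k) {s : ℝ}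
    (hs : s ∈ Set.Ioo ((p : ℝ) / 2 ^ k) (((p : ℝ) + 1) / 2 ^ k)) :
    rademacher (i + 1) s = (-1) ^ (p / 2 ^ (k - (i + 1))) := by
  obtain ⟨d, rfl⟩ : ∃ d, k = i + 1 + d := ⟨k - (i + 1), by omega⟩
  rw [Nat.add_sub_cancel_left]
  obtain ⟨hs₁, hs₂⟩ := hs
  rw [div_lt_iff₀ (by positivity), pow_add] at hs₁
  rw [lt_div_iff₀ (by positivity), pow_add] at hs₂
  set q := p / 2 ^ d with hq
  have hd : (0 : ℝ) < 2 ^ d := by positivity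
  have hq₁ : (q : ℝ) * 2 ^ d ≤ p := by exact_mod_cast Nat.div_mul_le_self p (2 ^ d)
  have hq₂ : (p : ℝ) + 1 ≤ (q + 1) * 2 ^ d := by
    exact_mod_cast Nat.lt_mul_of_div_lt (Nat.lt_succ_self q) (by positivity)
  have hx₁ : (q : ℝ) < 2 ^ (i + 1) * s := by
    refine lt_of_mul_lt_mul_right ?_ hd.le
    linarith
  have hx₂ : 2 ^ (i + 1) * s < (q : ℝ) + 1 := by
    refine lt_of_mul_lt_mul_right ?_ hd.le
    linarith
  have hpos : 0 < Real.sin (2 ^ (i + 1) * Real.pi * s - q * Real.pi) := by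
    apply Real.sin_pos_of_pos_of_lt_pi <;> nlinarith [Real.pi_pos]
  rw [Real.sin_sub_nat_mul_pi] at hpos
  rw [rademacher, if_neg i.succ_ne_zero]
  rcases neg_one_pow_eq_or ℝ q with h | h <;> rw [h] at hpos ⊢
  · exact Real.sign_of_pos (by linarith)
  · exact Real.sign_of_neg (by linarith)

/-- For `n < 2 ^ k`, the function `walsh n` takes on each open dyadic interval of length `2⁻ᵏ`
its value at the midpoint. -/
theorem walsh_eq_midpoint_of_mem_Ioo {n k p : ℕ} (hn : n < 2 ^ k) {s : ℝ}
    (hs : s ∈ Set.Ioo ((p : ℝ) / 2 ^ k) (((p : ℝ) + 1) / 2 ^ k)) :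
    walsh n s = walsh n ((2 * (p : ℝ) + 1) / (2 * 2 ^ k)) := by
  have hmid : (2 * (p : ℝ) + 1) / (2 * 2 ^ k) ∈
      Set.Ioo ((p : ℝ) / 2 ^ k) (((p : ℝ) + 1) / 2 ^ k) := by
    rw [← div_div]
    constructor <;> gcongr <;> linarith
  refine Finset.prod_congr rfl fun i _ => ?_
  split_ifs with hb
  · have hi : i < k := (Nat.pow_lt_pow_iff_right one_lt_two).1
      ((Nat.ge_two_pow_of_testBit hb).trans_lt hn)
    rw [rademacher_succ_eq_of_mem_Ioo hi hs, rademacher_succ_eq_of_mem_Ioo hi hmid]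
  · rfl

theorem intervalIntegrable_of_eqOn_Ioo_const {f : ℝ → ℝ} {a b c : ℝ} (hab : a ≤ b)
    (hf : ∀ x ∈ Set.Ioo a b, f x = c) : IntervalIntegrable f volume a b := by
  rw [intervalIntegrable_iff_integrableOn_Ioo_of_le hab]
  exact (integrableOn_const (by simp) (by simp)).congr_fun (fun x hx => (hf x hx).symm)
    measurableSet_Ioo

theorem integral_of_eqOn_Ioo_const {f : ℝ → ℝ} {a b c : ℝ} (hab : a ≤ b)
    (hf : ∀ x ∈ Set.Ioo a b, f x = c) : ∫ x in a..b, f x = (b - a) * c := by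
  rw [intervalIntegral.integral_of_le hab, integral_Ioc_eq_integral_Ioo,
    setIntegral_congr_fun measurableSet_Ioo hf]
  simp [hab]

/-- For `m = 2^k`, `h = 1/m`, midpoints `t_j = (2j+1)/(2m)` and
`η_p = (2p+1)/(2m)`: for `n, j < m`,
`∫₀^{t_j} w_n(s) ds = h·∑_{p<j} w_n(η_p) + (h/2)·w_n(η_j)`
(exactness of the Walsh operational matrix of integration
`Λ = (1/m) T_W P T_W` at the collocation midpoints). -/
theorem walsh_integral_at_midpoints (k n j : ℕ) (hn : n < 2 ^ k)
    (hj : j < 2 ^ k) :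
    ∫ s in (0:ℝ)..((2 * (j : ℝ) + 1) / (2 * 2 ^ k)), walsh n s =
      (1 / (2 ^ k : ℝ)) *
          ∑ p ∈ Finset.range j, walsh n ((2 * (p : ℝ) + 1) / (2 * 2 ^ k)) +
        (1 / (2 ^ k : ℝ) / 2) * walsh n ((2 * (j : ℝ) + 1) / (2 * 2 ^ k)) := by
  have hstep (p : ℕ) : (p : ℝ) / 2 ^ k ≤ ((p + 1 : ℕ) : ℝ) / 2 ^ k := by
    gcongr
    exact p.le_succ
  have hconst (p : ℕ) : ∀ x ∈ Set.Ioo ((p : ℝ) / 2 ^ k) (((p + 1 : ℕ) : ℝ) / 2 ^ k),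
      walsh n x = walsh n ((2 * (p : ℝ) + 1) / (2 * 2 ^ k)) := fun x hx =>
    walsh_eq_midpoint_of_mem_Ioo hn (by exact_mod_cast hx)
  have hint (p : ℕ) : IntervalIntegrable (walsh n) volume ((p : ℝ) / 2 ^ k)
      (((p + 1 : ℕ) : ℝ) / 2 ^ k) :=
    intervalIntegrable_of_eqOn_Ioo_const (hstep p) (hconst p)
  have hle : (j : ℝ) / 2 ^ k ≤ (2 * (j : ℝ) + 1) / (2 * 2 ^ k) := by
    rw [← div_div]
    gcongr
    linarith
  have hle' : (2 * (j : ℝ) + 1) / (2 * 2 ^ k) ≤ ((j + 1 : ℕ) : ℝ) / 2 ^ k := by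
    rw [← div_div]
    gcongr
    push_cast
    linarith
  have hlast : ∀ x ∈ Set.Ioo ((j : ℝ) / 2 ^ k) ((2 * (j : ℝ) + 1) / (2 * 2 ^ k)),
      walsh n x = walsh n ((2 * (j : ℝ) + 1) / (2 * 2 ^ k)) := fun x hx =>
    hconst j x ⟨hx.1, hx.2.trans_le hle'⟩
  have hsum := intervalIntegral.sum_integral_adjacent_intervals (n := j)
    (a := fun p : ℕ => (p : ℝ) / 2 ^ k) fun p _ => hint p
  have hinit := IntervalIntegrable.trans_iterate (n := j)
    (a := fun p : ℕ => (p : ℝ) / 2 ^ k) fun p _ => hint p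
  simp only [Nat.cast_zero, zero_div] at hsum hinit
  rw [← intervalIntegral.integral_add_adjacent_intervals hinit
    (intervalIntegrable_of_eqOn_Ioo_const hle hlast), ← hsum,
    integral_of_eqOn_Ioo_const hle hlast, Finset.mul_sum]
  congr 1
  · refine Finset.sum_congr rfl fun p _ => ?_
    rw [integral_of_eqOn_Ioo_const (hstep p) (hconst p)]
    push_cast
    ring
  · congr 1
    field_simp
    ring
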